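/- Let 0 < s < 1 and 1 ≤ p < ∞. There exist positive constants C₁ and C₂ (depending on N, s, p) such that for every measurable function f : ℝ^N → ℝ that is finite almost everywhere, C₁ [f]^p ≤ Σ_{j=1}^N ∬_{ℝ^N × ℝ} |f(x) - f(x + a e_j)|^p / |a|^{1+ps} dx da ≤ C₂ [f]^p, where [f]^p = ∬_{ℝ^N × ℝ^N} |f(x)-f(y)|^p / |x-y|^{N+sp} dx dy. -/

import Mathlib

open MeasureTheory ENNReal

/-- The `p`-th power of the Gagliardo seminorm of order `s`. -/
noncomputable def gagP {N : ℕ} (s p : ℝ) (f : EuclideanSpace ℝ (Fin N) → ℝ) : ℝ≥0∞ :=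
  ∫⁻ x, ∫⁻ y,
    ENNReal.ofReal (|f x - f y| ^ p) / ENNReal.ofReal (‖x - y‖ ^ ((N : ℝ) + s * p))

/-- The Gagliardo seminorm of order `s` and exponent `p`. -/
noncomputable def gagSemi {N : ℕ} (s p : ℝ) (f : EuclideanSpace ℝ (Fin N) → ℝ) : ℝ≥0∞ :=
  gagP s p f ^ (1 / p)

/-- The directional (one-dimensional difference) analogue of the Gagliardo seminorm's
`p`-th power, in the `j`-th coordinate direction. -/
noncomputable def dirP {N : ℕ} (s p : ℝ) (j : Fin N) (f : EuclideanSpace ℝ (Fin N) → ℝ) :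
    ℝ≥0∞ :=
  ∫⁻ x, ∫⁻ a : ℝ,
    ENNReal.ofReal (|f x - f (x + a • EuclideanSpace.single j 1)| ^ p) /
      ENNReal.ofReal (|a| ^ (1 + p * s))

/-- The `L^p` modulus `∫ |f x - f (x + h)| ^ p dx` of a shift by `h`. -/
noncomputable def shiftEnergy {N : ℕ} (p : ℝ) (f : EuclideanSpace ℝ (Fin N) → ℝ)
    (h : EuclideanSpace ℝ (Fin N)) : ℝ≥0∞ :=
  ∫⁻ x, ENNReal.ofReal (|f x - f (x + h)| ^ p)

section ShiftEnergy

variable {N : ℕ} {s p : ℝ} {f : EuclideanSpace ℝ (Fin N) → ℝ}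

theorem measurable_shiftEnergy (hf : Measurable f) : Measurable (shiftEnergy p f) := by
  unfold shiftEnergy
  refine Measurable.lintegral_prod_right' (f := fun z : EuclideanSpace ℝ (Fin N) ×
    EuclideanSpace ℝ (Fin N) => ENNReal.ofReal (|f z.2 - f (z.2 + z.1)| ^ p)) ?_
  fun_prop

theorem shiftEnergy_zero (hp : 0 < p) : shiftEnergy p f 0 = 0 := by
  simp [shiftEnergy, Real.zero_rpow hp.ne']

theorem shiftEnergy_add_le (hp : 1 ≤ p) (hf : Measurable f) (u v : EuclideanSpace ℝ (Fin N)) :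
    shiftEnergy p f (u + v) ≤ 2 ^ (p - 1) * (shiftEnergy p f u + shiftEnergy p f v) := by
  have hp0 : 0 ≤ p := zero_le_one.trans hp
  have hv : shiftEnergy p f v = ∫⁻ x, ENNReal.ofReal (|f (x + u) - f (x + u + v)| ^ p) :=
    (lintegral_add_right_eq_self (fun x => ENNReal.ofReal (|f x - f (x + v)| ^ p)) u).symm
  have hm : Measurable fun x => ENNReal.ofReal (|f x - f (x + u)| ^ p) := by fun_prop
  rw [hv, shiftEnergy, shiftEnergy, ← lintegral_add_left hm, ← lintegral_const_mul _ (by fun_prop)]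
  refine lintegral_mono fun x => ?_
  simp only [← ENNReal.ofReal_rpow_of_nonneg (abs_nonneg _) hp0]
  refine le_trans ?_ (ENNReal.rpow_add_le_mul_rpow_add_rpow _ _ hp)
  rw [← ENNReal.ofReal_add (abs_nonneg _) (abs_nonneg _), ← add_assoc x]
  gcongr
  exact abs_sub_le _ _ _

theorem gagP_eq_lintegral_shiftEnergy (hf : Measurable f) :
    gagP s p f = ∫⁻ h, shiftEnergy p f h / ENNReal.ofReal (‖h‖ ^ ((N : ℝ) + s * p)) := by
  have key : ∀ x, (∫⁻ y, ENNReal.ofReal (|f x - f y| ^ p) /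
      ENNReal.ofReal (‖x - y‖ ^ ((N : ℝ) + s * p))) =
      ∫⁻ h, ENNReal.ofReal (|f x - f (x + h)| ^ p) /
        ENNReal.ofReal (‖h‖ ^ ((N : ℝ) + s * p)) := by
    intro x
    rw [← lintegral_add_left_eq_self _ x]
    simp
  simp only [gagP, key]
  rw [lintegral_lintegral_swap (by unfold Function.uncurry; fun_prop)]
  refine lintegral_congr fun h => ?_
  simp only [div_eq_mul_inv, shiftEnergy]
  rw [lintegral_mul_const _ (by fun_prop)]

theorem dirP_eq_lintegral_shiftEnergy (hf : Measurable f) (j : Fin N) :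
    dirP s p j f = ∫⁻ a : ℝ, shiftEnergy p f (a • EuclideanSpace.single j 1) /
      ENNReal.ofReal (|a| ^ (1 + p * s)) := by
  simp only [dirP]
  rw [lintegral_lintegral_swap (by unfold Function.uncurry; fun_prop)]
  refine lintegral_congr fun h => ?_
  simp only [div_eq_mul_inv, shiftEnergy]
  rw [lintegral_mul_const _ (by fun_prop)]

end ShiftEnergy

theorem sum_le_pow_card_mul_sum_of_quasi_subadditive {E ι : Type*} [AddCommMonoid E]
    {φ : E → ℝ≥0∞} {c : ℝ≥0∞} (hc : 1 ≤ c) (h0 : φ 0 = 0)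
    (hadd : ∀ u v, φ (u + v) ≤ c * (φ u + φ v)) (t : Finset ι) (v : ι → E) :
    φ (∑ i ∈ t, v i) ≤ c ^ t.card * ∑ i ∈ t, φ (v i) := by
  classical
  induction t using Finset.induction_on with
  | empty => simp [h0]
  | insert i t hi ih =>
    rw [Finset.sum_insert hi, Finset.sum_insert hi, Finset.card_insert_of_notMem hi]
    refine (hadd _ _).trans ?_
    rw [pow_succ', mul_assoc]
    gcongr
    rw [mul_add]
    gcongr
    exact le_mul_of_one_le_left' (one_le_pow₀ hc)

theorem lintegral_add_norm_rpow_neg {E : Type*} [NormedAddCommGroup E] [NormedSpace ℝ E]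
    [FiniteDimensional ℝ E] [MeasurableSpace E] [BorelSpace E] (μ : Measure E)
    [μ.IsAddHaarMeasure] {r : ℝ} (hr : 0 < r) (q : ℝ) :
    ∫⁻ u, ENNReal.ofReal ((r + ‖u‖) ^ (-q)) ∂μ =
      ENNReal.ofReal (r ^ ((Module.finrank ℝ E : ℝ) - q)) *
        ∫⁻ u, ENNReal.ofReal ((1 + ‖u‖) ^ (-q)) ∂μ := by
  have hmap := Measure.map_addHaar_smul μ (inv_ne_zero hr.ne')
  have hscale : ∀ u : E, ENNReal.ofReal ((r + ‖u‖) ^ (-q)) =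
      ENNReal.ofReal (r ^ (-q)) * ENNReal.ofReal ((1 + ‖r⁻¹ • u‖) ^ (-q)) := by
    intro u
    rw [← ENNReal.ofReal_mul (by positivity), ← Real.mul_rpow hr.le (by positivity),
      norm_smul, Real.norm_of_nonneg (inv_nonneg.2 hr.le), mul_add, mul_one,
      mul_inv_cancel_left₀ hr.ne']
  simp_rw [hscale]
  rw [lintegral_const_mul _ (by fun_prop),
    ← lintegral_map (f := fun u : E => ENNReal.ofReal ((1 + ‖u‖) ^ (-q)))
      (g := fun u : E => r⁻¹ • u) (by fun_prop) (by fun_prop), hmap,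
    lintegral_smul_measure, smul_eq_mul, ← mul_assoc, ← ENNReal.ofReal_mul (by positivity)]
  congr 2
  rw [inv_pow, inv_inv, abs_of_nonneg (by positivity), ← Real.rpow_natCast,
    ← Real.rpow_add hr]
  ring_nf

theorem ofReal_rpow_inv_le {a b q : ℝ} (ha : 0 < a) (hab : b ≤ 2 * a) (hb : 0 < b) (hq : 0 ≤ q) :
    (ENNReal.ofReal (a ^ q))⁻¹ ≤ ENNReal.ofReal (2 ^ q) * ENNReal.ofReal (b ^ (-q)) := by
  rw [← ENNReal.ofReal_inv_of_pos (by positivity), ← ENNReal.ofReal_mul (by positivity)]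
  refine ENNReal.ofReal_le_ofReal ?_
  rw [Real.rpow_neg hb.le, ← div_eq_mul_inv, ← Real.div_rpow (by norm_num) hb.le,
    ← Real.inv_rpow ha.le]
  refine Real.rpow_le_rpow (by positivity) ?_ hq
  rw [inv_le_iff_one_le_mul₀ ha, div_mul_eq_mul_div, one_le_div hb]
  exact hab

theorem lintegral_coord_div_norm_rpow_le {n : ℕ} {σ : ℝ} (hσ : 0 < σ) (j : Fin (n + 1))
    {ψ : ℝ → ℝ≥0∞} (hψ : Measurable ψ) :
    ∫⁻ h : EuclideanSpace ℝ (Fin (n + 1)),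
        ψ (h j) / ENNReal.ofReal (‖h‖ ^ (((n + 1 : ℕ) : ℝ) + σ)) ≤
      ENNReal.ofReal (2 ^ (((n + 1 : ℕ) : ℝ) + σ)) *
        (∫⁻ u : Fin n → ℝ, ENNReal.ofReal ((1 + ‖u‖) ^ (-(((n + 1 : ℕ) : ℝ) + σ)))) *
        ∫⁻ t : ℝ, ψ t / ENNReal.ofReal (|t| ^ (1 + σ)) := by
  set q : ℝ := ((n + 1 : ℕ) : ℝ) + σ with hq
  have hq0 : 0 ≤ q := by positivity
  rw [← (PiLp.volume_preserving_toLp (Fin (n + 1))).lintegral_comp (by fun_prop),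
    ← ((volume_preserving_piFinSuccAbove (fun _ : Fin (n + 1) => ℝ) j).symm).lintegral_comp
      (by fun_prop), Measure.volume_eq_prod, lintegral_prod _ (by fun_prop),
    ← lintegral_const_mul _ (by fun_prop)]
  refine lintegral_mono_ae ?_
  filter_upwards [Measure.ae_ne volume (0 : ℝ)] with t ht
  have ht' : 0 < |t| := abs_pos.2 ht
  calc _ ≤ ∫⁻ u : Fin n → ℝ, ψ t * (ENNReal.ofReal (2 ^ q) *
        ENNReal.ofReal ((|t| + ‖u‖) ^ (-q))) := by
        refine lintegral_mono fun u => ?_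
        set h : EuclideanSpace ℝ (Fin (n + 1)) :=
          WithLp.toLp 2 ((MeasurableEquiv.piFinSuccAbove (fun _ : Fin (n + 1) => ℝ) j).symm (t, u))
          with hh
        have hj : h j = t := by simp [hh, MeasurableEquiv.piFinSuccAbove_symm_apply]
        have hk : ∀ k, h (j.succAbove k) = u k := fun k => by
          simp [hh, MeasurableEquiv.piFinSuccAbove_symm_apply]
        have h1 : |t| ≤ ‖h‖ := by simpa [hj] using PiLp.norm_apply_le h j
        have h2 : ‖u‖ ≤ ‖h‖ := (pi_norm_le_iff_of_nonneg (norm_nonneg _)).2 fun k => by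
          simpa [hk] using PiLp.norm_apply_le h (j.succAbove k)
        change ψ (h j) / ENNReal.ofReal (‖h‖ ^ q) ≤ _
        rw [hj, div_eq_mul_inv]
        gcongr
        exact ofReal_rpow_inv_le (ht'.trans_le h1) (by linarith) (by positivity) hq0
    _ = _ := by
        rw [lintegral_const_mul _ (by fun_prop), lintegral_const_mul _ (by fun_prop),
          lintegral_add_norm_rpow_neg volume ht' q]
        have : ((Module.finrank ℝ (Fin n → ℝ) : ℝ) - q) = -(1 + σ) := by
          simp [hq]; ring
        rw [this, Real.rpow_neg ht'.le, ENNReal.ofReal_inv_of_pos (by positivity), div_eq_mul_inv]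
        ring

theorem le_lintegral_of_quasi_subadditive {N : ℕ} (hN : 1 ≤ N)
    {φ : EuclideanSpace ℝ (Fin N) → ℝ≥0∞} (hφ : Measurable φ) {c : ℝ≥0∞}
    (hadd : ∀ u v, φ (u + v) ≤ c * (φ u + φ v)) (w : EuclideanSpace ℝ (Fin N)) :
    volume (Metric.closedBall (0 : EuclideanSpace ℝ (Fin N)) 2⁻¹) *
        ENNReal.ofReal (‖w‖ ^ N) * φ w ≤
      2 * c * ∫⁻ y in Metric.closedBall 0 ‖w‖, φ y := by
  set A := Metric.closedBall (0 : EuclideanSpace ℝ (Fin N)) ‖w‖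
  set B := Metric.closedBall ((2⁻¹ : ℝ) • w) (‖w‖ * 2⁻¹)
  have hw2 : ‖(2⁻¹ : ℝ) • w‖ = ‖w‖ * 2⁻¹ := by
    rw [norm_smul, mul_comm]; norm_num
  have hvol : volume B = volume (Metric.closedBall (0 : EuclideanSpace ℝ (Fin N)) 2⁻¹) *
      ENNReal.ofReal (‖w‖ ^ N) := by
    have : Nonempty (Fin N) := ⟨⟨0, hN⟩⟩
    rw [Measure.addHaar_closedBall_mul _ _ (norm_nonneg _) (by norm_num), mul_comm]
    simp
  have hBA : ∀ y ∈ B, y ∈ A ∧ w - y ∈ A := by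
    intro y hy
    rw [mem_closedBall_iff_norm] at hy
    simp only [A, mem_closedBall_zero_iff]
    constructor
    · calc ‖y‖ = ‖(y - (2⁻¹ : ℝ) • w) + (2⁻¹ : ℝ) • w‖ := by simp
        _ ≤ _ := (norm_add_le _ _).trans (by rw [hw2]; linarith)
    · calc ‖w - y‖ = ‖(2⁻¹ : ℝ) • w - (y - (2⁻¹ : ℝ) • w)‖ := by
            congr 1; module
        _ ≤ _ := (norm_sub_le _ _).trans (by rw [hw2]; linarith)
  have hA : MeasurableSet A := measurableSet_closedBall
  have hm : Measurable (A.indicator φ) := hφ.indicator hA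
  calc _ = ∫⁻ _ in B, φ w := by rw [setLIntegral_const, hvol, mul_comm]
    _ ≤ ∫⁻ y in B, c * (A.indicator φ y + A.indicator φ (w - y)) := by
        refine setLIntegral_mono (by fun_prop) fun y hy => ?_
        rw [Set.indicator_of_mem (hBA y hy).1, Set.indicator_of_mem (hBA y hy).2]
        simpa using hadd y (w - y)
    _ ≤ ∫⁻ y, c * (A.indicator φ y + A.indicator φ (w - y)) := setLIntegral_le_lintegral _ _
    _ = _ := by
        rw [lintegral_const_mul _ (by fun_prop), lintegral_add_left hm,
          lintegral_sub_left_eq_self, lintegral_indicator hA]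
        ring

theorem lintegral_smul_div_rpow_le {N : ℕ} (hN : 1 ≤ N) {σ : ℝ} (hσ : 0 < σ)
    {φ : EuclideanSpace ℝ (Fin N) → ℝ≥0∞} (hφ : Measurable φ) {c : ℝ≥0∞}
    (hadd : ∀ u v, φ (u + v) ≤ c * (φ u + φ v)) {e : EuclideanSpace ℝ (Fin N)} (he : ‖e‖ = 1) :
    ∫⁻ a : ℝ, φ (a • e) / ENNReal.ofReal (|a| ^ (1 + σ)) ≤
      ((volume (Metric.closedBall (0 : EuclideanSpace ℝ (Fin N)) 2⁻¹))⁻¹ * (2 * c) *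
        ENNReal.ofReal (2 ^ (N + (1 + σ))) *
        ∫⁻ a : ℝ, ENNReal.ofReal ((1 + ‖a‖) ^ (-(N + (1 + σ))))) *
      ∫⁻ h, φ h / ENNReal.ofReal (‖h‖ ^ ((N : ℝ) + σ)) := by
  set q : ℝ := N + (1 + σ) with hq
  have hq0 : 0 ≤ q := by positivity
  set V := volume (Metric.closedBall (0 : EuclideanSpace ℝ (Fin N)) 2⁻¹)
  have hV0 : V ≠ 0 := (Metric.measure_closedBall_pos _ _ (by norm_num)).ne'
  have hVt : V ≠ ⊤ := measure_closedBall_lt_top.ne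
  have : Nonempty (Fin N) := ⟨⟨0, hN⟩⟩
  calc _ ≤ ∫⁻ a : ℝ, (V⁻¹ * (2 * c) * ENNReal.ofReal (2 ^ q)) *
        ∫⁻ y, φ y * ENNReal.ofReal ((‖y‖ + ‖a‖) ^ (-q)) := by
        refine lintegral_mono_ae ?_
        filter_upwards [Measure.ae_ne volume (0 : ℝ)] with a ha
        have ha' : 0 < |a| := abs_pos.2 ha
        have hae : ‖a • e‖ = |a| := by rw [norm_smul, he, mul_one, Real.norm_eq_abs]
        have hmain := le_lintegral_of_quasi_subadditive hN hφ hadd (a • e)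
        rw [hae] at hmain
        have hpow : ENNReal.ofReal (|a| ^ q) =
            ENNReal.ofReal (|a| ^ N) * ENNReal.ofReal (|a| ^ (1 + σ)) := by
          rw [← ENNReal.ofReal_mul (by positivity), hq, Real.rpow_add ha', Real.rpow_natCast]
        have hpos : ENNReal.ofReal (|a| ^ N) ≠ 0 := by
          simpa using fun h => absurd h ha
        calc φ (a • e) / ENNReal.ofReal (|a| ^ (1 + σ))
            = V⁻¹ * (V * ENNReal.ofReal (|a| ^ N) * φ (a • e)) *
              (ENNReal.ofReal (|a| ^ q))⁻¹ := by
              rw [hpow, ENNReal.mul_inv (Or.inl hpos) (Or.inl ENNReal.ofReal_ne_top),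
                div_eq_mul_inv]
              calc _ = (V⁻¹ * V) * (ENNReal.ofReal (|a| ^ N) * (ENNReal.ofReal (|a| ^ N))⁻¹) *
                    (φ (a • e) * (ENNReal.ofReal (|a| ^ (1 + σ)))⁻¹) := by
                    rw [ENNReal.inv_mul_cancel hV0 hVt,
                      ENNReal.mul_inv_cancel hpos ENNReal.ofReal_ne_top, one_mul, one_mul]
                _ = _ := by ring
          _ ≤ V⁻¹ * (2 * c * ∫⁻ y in Metric.closedBall 0 |a|, φ y) *
              (ENNReal.ofReal (|a| ^ q))⁻¹ := by gcongr
          _ = V⁻¹ * (2 * c) * ∫⁻ y in Metric.closedBall 0 |a|, φ y *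
              (ENNReal.ofReal (|a| ^ q))⁻¹ := by
              rw [lintegral_mul_const _ hφ]; ring
          _ ≤ V⁻¹ * (2 * c) * ∫⁻ y in Metric.closedBall 0 |a|, ENNReal.ofReal (2 ^ q) *
              (φ y * ENNReal.ofReal ((‖y‖ + ‖a‖) ^ (-q))) := by
              refine mul_le_mul' le_rfl ?_
              refine setLIntegral_mono (by fun_prop) fun y hy => ?_
              rw [mem_closedBall_zero_iff] at hy
              rw [mul_left_comm]
              gcongr
              rw [Real.norm_eq_abs]
              exact ofReal_rpow_inv_le ha' (by linarith) (by positivity) hq0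
          _ ≤ V⁻¹ * (2 * c) * ∫⁻ y, ENNReal.ofReal (2 ^ q) *
              (φ y * ENNReal.ofReal ((‖y‖ + ‖a‖) ^ (-q))) := by
              refine mul_le_mul' le_rfl ?_
              exact setLIntegral_le_lintegral _ _
          _ = _ := by rw [lintegral_const_mul _ (by fun_prop)]; ring
    _ = (V⁻¹ * (2 * c) * ENNReal.ofReal (2 ^ q)) *
        ∫⁻ y, ∫⁻ a : ℝ, φ y * ENNReal.ofReal ((‖y‖ + ‖a‖) ^ (-q)) := by
        rw [lintegral_const_mul, lintegral_lintegral_swap (by unfold Function.uncurry; fun_prop)]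
        exact Measurable.lintegral_prod_right' (f := fun z : ℝ × EuclideanSpace ℝ (Fin N) =>
          φ z.2 * ENNReal.ofReal ((‖z.2‖ + ‖z.1‖) ^ (-q))) (by fun_prop)
    _ = (V⁻¹ * (2 * c) * ENNReal.ofReal (2 ^ q)) *
        ∫⁻ y, (∫⁻ a : ℝ, ENNReal.ofReal ((1 + ‖a‖) ^ (-q))) *
          (φ y / ENNReal.ofReal (‖y‖ ^ ((N : ℝ) + σ))) := by
        congr 1
        refine lintegral_congr_ae ?_
        filter_upwards [Measure.ae_ne volume (0 : EuclideanSpace ℝ (Fin N))] with y hy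
        have hy' : 0 < ‖y‖ := norm_pos_iff.2 hy
        rw [lintegral_const_mul _ (by fun_prop), lintegral_add_norm_rpow_neg volume hy' q]
        have : ((Module.finrank ℝ ℝ : ℝ) - q) = -(N + σ) := by
          simp [hq]; ring
        rw [this, Real.rpow_neg hy'.le, ENNReal.ofReal_inv_of_pos (by positivity), div_eq_mul_inv]
        ring
    _ = _ := by rw [lintegral_const_mul _ (by fun_prop)]; ring

theorem stmt10 {N : ℕ} (hN : 1 ≤ N) (s p : ℝ) (hs0 : 0 < s) (hs1 : s < 1) (hp : 1 ≤ p) :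
    ∃ C₁ C₂ : ℝ≥0∞, 0 < C₁ ∧ 0 < C₂ ∧ C₁ < ⊤ ∧ C₂ < ⊤ ∧
      ∀ f : EuclideanSpace ℝ (Fin N) → ℝ, Measurable f →
        C₁ * gagP s p f ≤ ∑ j : Fin N, dirP s p j f ∧
        ∑ j : Fin N, dirP s p j f ≤ C₂ * gagP s p f := by
  have hp0 : 0 < p := zero_lt_one.trans_le hp
  have hσ : 0 < s * p := mul_pos hs0 hp0
  obtain ⟨n, rfl⟩ : ∃ n, N = n + 1 := ⟨N - 1, by omega⟩
  set c : ℝ≥0∞ := 2 ^ (p - 1)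
  have hc1 : 1 ≤ c := by
    simpa using ENNReal.rpow_le_rpow (one_le_two (α := ℝ≥0∞)) (sub_nonneg.2 hp)
  have hct : c ≠ ⊤ := ENNReal.rpow_ne_top_of_nonneg (by linarith) ENNReal.ofNat_ne_top
  set K : ℝ≥0∞ := ENNReal.ofReal (2 ^ (((n + 1 : ℕ) : ℝ) + s * p)) *
    ∫⁻ u : Fin n → ℝ, ENNReal.ofReal ((1 + ‖u‖) ^ (-(((n + 1 : ℕ) : ℝ) + s * p)))
  have hK : K ≠ ⊤ := ENNReal.mul_ne_top ENNReal.ofReal_ne_top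
    (finite_integral_one_add_norm (by simp; linarith)).ne
  set L : ℝ≥0∞ := (volume (Metric.closedBall (0 : EuclideanSpace ℝ (Fin (n + 1))) 2⁻¹))⁻¹ *
    (2 * c) * ENNReal.ofReal (2 ^ (((n + 1 : ℕ) : ℝ) + (1 + s * p))) *
    ∫⁻ a : ℝ, ENNReal.ofReal ((1 + ‖a‖) ^ (-(((n + 1 : ℕ) : ℝ) + (1 + s * p))))
  have hL : L ≠ ⊤ := by
    refine ENNReal.mul_ne_top (ENNReal.mul_ne_top (ENNReal.mul_ne_top ?_ ?_)
      ENNReal.ofReal_ne_top) (finite_integral_one_add_norm ?_).ne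
    · exact ENNReal.inv_ne_top.2 (Metric.measure_closedBall_pos _ _ (by norm_num)).ne'
    · exact ENNReal.mul_ne_top ENNReal.ofNat_ne_top hct
    · simp only [Module.finrank_self, Nat.cast_one]
      have : (0 : ℝ) ≤ ((n + 1 : ℕ) : ℝ) := Nat.cast_nonneg _
      linarith
  have hM : c ^ (n + 1) * K + 1 ≠ ⊤ :=
    ENNReal.add_ne_top.2 ⟨ENNReal.mul_ne_top (ENNReal.pow_ne_top hct) hK, ENNReal.one_ne_top⟩
  refine ⟨(c ^ (n + 1) * K + 1)⁻¹, (n + 1 : ℕ) * L + 1, ENNReal.inv_pos.2 hM,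
    by positivity, ENNReal.inv_lt_top.2 (by positivity),
    (ENNReal.add_ne_top.2
      ⟨ENNReal.mul_ne_top (ENNReal.natCast_ne_top _) hL, ENNReal.one_ne_top⟩).lt_top,
    fun f hf => ⟨?_, ?_⟩⟩
  · rw [mul_comm, ← div_eq_mul_inv]
    refine ENNReal.div_le_of_le_mul' ?_
    calc gagP s p f ≤ ∫⁻ h : EuclideanSpace ℝ (Fin (n + 1)), c ^ (n + 1) * ∑ j,
          shiftEnergy p f (h j • EuclideanSpace.single j 1) /
            ENNReal.ofReal (‖h‖ ^ (((n + 1 : ℕ) : ℝ) + s * p)) := by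
          rw [gagP_eq_lintegral_shiftEnergy hf]
          refine lintegral_mono fun h => ?_
          simp only [div_eq_mul_inv]
          rw [← Finset.sum_mul, ← mul_assoc]
          gcongr
          have := sum_le_pow_card_mul_sum_of_quasi_subadditive hc1 (shiftEnergy_zero (f := f) hp0)
            (shiftEnergy_add_le hp hf) Finset.univ
            fun j => h j • (EuclideanSpace.single j 1 : EuclideanSpace ℝ (Fin (n + 1)))
          have hsum : ∑ j, h j • (EuclideanSpace.single j 1 : EuclideanSpace ℝ (Fin (n + 1))) = h := by
            simpa using (EuclideanSpace.basisFun (Fin (n + 1)) ℝ).sum_repr h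
          simpa only [hsum, Finset.card_univ, Fintype.card_fin] using this
      _ ≤ c ^ (n + 1) * ∑ j, K * dirP s p j f := by
          have hφ := measurable_shiftEnergy (p := p) hf
          rw [lintegral_const_mul _ (by fun_prop), lintegral_finsetSum _ (by fun_prop)]
          gcongr with j
          rw [dirP_eq_lintegral_shiftEnergy hf, mul_comm p s]
          exact lintegral_coord_div_norm_rpow_le hσ j
            (ψ := fun t => shiftEnergy p f (t • EuclideanSpace.single j 1)) (by fun_prop)
      _ ≤ _ := by
          rw [← Finset.mul_sum, ← mul_assoc]
          gcongr
          exact le_self_add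
  · calc ∑ j, dirP s p j f ≤ ∑ _j : Fin (n + 1), L * gagP s p f := by
          gcongr with j
          rw [dirP_eq_lintegral_shiftEnergy hf, gagP_eq_lintegral_shiftEnergy hf, mul_comm p s]
          exact lintegral_smul_div_rpow_le hN hσ (measurable_shiftEnergy hf)
            (shiftEnergy_add_le hp hf) (by simp)
      _ ≤ _ := by
          rw [Finset.sum_const, Finset.card_univ, Fintype.card_fin, nsmul_eq_mul, ← mul_assoc]
          gcongr
          exact le_self_add
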